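/- Eigenvalue multiplicities of the one-form symmetry (cyclic shift) on the vacua: for every integer N ≥ 1 and every integer m, the ℂ-dimension of the eigenspace of P_σ with eigenvalue exp(2πi m/N) satisfies N · dim_ℂ eigenspace(P_σ, exp(2πi m/N)) = ∑_{d ∣ N, d odd, d ∣ m} d · A_{N/d}. (Physically, dividing by N gives the number C_m^N of vacua of the Spin(N²−1)_1/SU(N)_N TQFT in the universe of one-form charge m.) -/

import Mathlib

/-- An admissible `N`-tuple: `λ : Fin N → ℕ` with `∑ (λᵢ + 1) = 2N` and every consecutive
sum `∑_{k=i}^{j} (λₖ + 1) ≠ N` for `i ≤ j`. -/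
def Admissible (N : ℕ) (lam : Fin N → ℕ) : Prop :=
  (∑ i, (lam i + 1)) = 2 * N ∧
  ∀ i j : Fin N, i ≤ j → (∑ k ∈ Finset.Icc i j, (lam k + 1)) ≠ N

/-- `λ` is `d`-periodic: `λ_{(k+d) mod N} = λ_k` for all `k`. -/
def IsPeriodic (N d : ℕ) (lam : Fin N → ℕ) : Prop :=
  ∀ k : Fin N, lam ⟨((k : ℕ) + d) % N, Nat.mod_lt _ (Nat.zero_lt_of_lt k.isLt)⟩ = lam k

/-- `λ` is aperiodic: the only `d` with `1 ≤ d ≤ N` for which `λ` is `d`-periodic is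
`d = N`. -/
def Aperiodic (N : ℕ) (lam : Fin N → ℕ) : Prop :=
  ∀ d : ℕ, 1 ≤ d → d ≤ N → IsPeriodic N d lam → d = N

/-- `A m` is the number of aperiodic admissible `m`-tuples. -/
noncomputable def numAperiodic (m : ℕ) : ℕ :=
  Nat.card {lam : Fin m → ℕ // Admissible m lam ∧ Aperiodic m lam}

/-- The cyclic shift `(σλ)_k = λ_{(k+1) mod N}`. -/
def shift (N : ℕ) (lam : Fin N → ℕ) : Fin N → ℕ :=
  fun k => lam ⟨((k : ℕ) + 1) % N, Nat.mod_lt _ (Nat.zero_lt_of_lt k.isLt)⟩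

section Trace

variable {X : Type*} [Fintype X] [DecidableEq X]

theorem trace_funLeft (τ : X → X) :
    LinearMap.trace ℂ (X → ℂ) (LinearMap.funLeft ℂ ℂ τ) = ∑ x, if τ x = x then (1 : ℂ) else 0 := by
  rw [LinearMap.trace_eq_matrix_trace ℂ (Pi.basisFun ℂ X), Matrix.trace]
  refine Finset.sum_congr rfl fun x _ => ?_
  simp [LinearMap.funLeft_apply, Pi.single_apply]

theorem funLeft_pow (τ : X → X) (k : ℕ) :
    LinearMap.funLeft ℂ ℂ τ ^ k = LinearMap.funLeft ℂ ℂ τ^[k] := by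
  induction k with
  | zero => ext; simp
  | succ k ih =>
    rw [pow_succ, ih, Function.iterate_succ', LinearMap.funLeft_comp, Module.End.mul_eq_comp]

/-- The average of the powers of an endomorphism of finite order is a projection onto its
fixed space. -/
theorem isProj_average {V : Type*} [AddCommGroup V] [Module ℂ V] (P : Module.End ℂ V) {N : ℕ}
    (hN : N ≠ 0) {ω : ℂ} (hω : ω ≠ 0) (h : (ω⁻¹ • P) ^ N = 1) :
    LinearMap.IsProj (P.eigenspace ω) ((N : ℂ)⁻¹ • ∑ k ∈ Finset.range N, (ω⁻¹ • P) ^ k) where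
  map_mem v := by
    have key := mul_geom_sum (ω⁻¹ • P) N
    rw [h, sub_self, sub_mul, one_mul, sub_eq_zero] at key
    have key' := congrArg (fun T : Module.End ℂ V => ω • T v) key
    simp only [Module.End.mul_apply, LinearMap.smul_apply, smul_inv_smul₀ hω] at key'
    rw [Module.End.mem_eigenspace_iff, LinearMap.smul_apply, map_smul, key', smul_comm]
  map_id v hv := by
    rw [Module.End.mem_eigenspace_iff] at hv
    have hQ : (ω⁻¹ • P) v = v := by rw [LinearMap.smul_apply, hv, inv_smul_smul₀ hω]
    have hk (k : ℕ) : ((ω⁻¹ • P) ^ k) v = v := by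
      induction k with
      | zero => simp
      | succ k ih => rw [pow_succ, Module.End.mul_apply, hQ, ih]
    simp [LinearMap.sum_apply, hk, ← Nat.cast_smul_eq_nsmul ℂ, hN]

theorem sum_pow_filter_dvd {ζ : ℂ} {N p : ℕ} (hN : N ≠ 0) (hp : p ∣ N) (hζ : ζ ^ N = 1) :
    (∑ k ∈ Finset.range N, if p ∣ k then ζ ^ k else 0)
      = if ζ ^ p = 1 then ((N / p : ℕ) : ℂ) else 0 := by
  obtain ⟨d, rfl⟩ := hp
  have hp0 : 0 < p := Nat.pos_of_ne_zero (left_ne_zero_of_mul hN)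
  have hsum : (∑ k ∈ Finset.range (p * d), if p ∣ k then ζ ^ k else 0)
      = ∑ j ∈ Finset.range d, (ζ ^ p) ^ j := by
    rw [← Finset.sum_filter]
    symm
    refine Finset.sum_nbij (p * ·) ?_ ?_ ?_ ?_
    · intro j hj
      simpa [hp0] using hj
    · intro a _ b _ hab
      exact Nat.eq_of_mul_eq_mul_left hp0 hab
    · rintro k hk
      obtain ⟨hk, j, rfl⟩ := by simpa using hk
      exact ⟨j, by simpa using lt_of_mul_lt_mul_left hk hp0.le, rfl⟩
    · intro j _
      rw [pow_mul]
  rw [hsum, Nat.mul_div_cancel_left _ hp0]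
  split_ifs with h
  · simp [h]
  · rw [geom_sum_eq h, ← pow_mul, hζ, sub_self, zero_div]

theorem mul_finrank_eigenspace_funLeft (σ : X → X) {N : ℕ} (hN : N ≠ 0) (hσ : σ^[N] = id)
    {ω : ℂ} (hω : ω ^ N = 1) :
    N * Module.finrank ℂ (Module.End.eigenspace (LinearMap.funLeft ℂ ℂ σ) ω)
      = ∑ x, if ω ^ Function.minimalPeriod σ x = 1 then N / Function.minimalPeriod σ x else 0 := by
  have hω0 : ω ≠ 0 := by rintro rfl; simp [hN] at hω
  have hpow : (ω⁻¹ • LinearMap.funLeft ℂ ℂ σ) ^ N = 1 := by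
    rw [smul_pow, inv_pow, hω, funLeft_pow, hσ, inv_one, one_smul]
    rfl
  have htr := (isProj_average _ hN hω0 hpow).trace
  have hNC : (N : ℂ) ≠ 0 := Nat.cast_ne_zero.mpr hN
  rw [map_smul, map_sum, smul_eq_mul, inv_mul_eq_iff_eq_mul₀ hNC] at htr
  have hdvd (x : X) : Function.minimalPeriod σ x ∣ N :=
    Function.IsPeriodicPt.minimalPeriod_dvd (congrFun hσ x)
  apply Nat.cast_injective (R := ℂ)
  push_cast
  rw [← htr]
  simp_rw [smul_pow, map_smul, funLeft_pow, trace_funLeft, smul_eq_mul, Finset.mul_sum]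
  rw [Finset.sum_comm]
  refine Finset.sum_congr rfl fun x _ => ?_
  have := sum_pow_filter_dvd (ζ := ω⁻¹) hN (hdvd x) (by rw [inv_pow, hω, inv_one])
  simp only [inv_pow, inv_eq_one] at this
  rw [← this]
  refine Finset.sum_congr rfl fun k _ => ?_
  have hiff : σ^[k] x = x ↔ Function.minimalPeriod σ x ∣ k :=
    Function.isPeriodicPt_iff_minimalPeriod_dvd
  simp [hiff]

end Trace

section Sequences

/-- The sum of `l` consecutive terms `f k + 1` starting at index `a`. -/
def blockSum (f : ℕ → ℕ) (a l : ℕ) : ℕ := ∑ k ∈ Finset.range l, (f (a + k) + 1)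

/-- The `N`-periodic sequences whose restriction to one period is an admissible tuple. -/
def AdmissibleSeq (N : ℕ) (f : ℕ → ℕ) : Prop :=
  Function.Periodic f N ∧ blockSum f 0 N = 2 * N ∧ ∀ a l, blockSum f a l ≠ N

/-- `p` is the least positive period of `f`. -/
def IsLeastPeriod (f : ℕ → ℕ) (p : ℕ) : Prop :=
  Function.Periodic f p ∧ ∀ d, 1 ≤ d → d ≤ p → Function.Periodic f d → d = p

variable {f : ℕ → ℕ} {p : ℕ}

theorem blockSum_add (f : ℕ → ℕ) (a l l' : ℕ) :
    blockSum f a (l + l') = blockSum f a l + blockSum f (a + l) l' := by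
  simp [blockSum, Finset.sum_range_add, add_assoc]

theorem blockSum_lt_blockSum (f : ℕ → ℕ) (a : ℕ) {l l' : ℕ} (h : l < l') :
    blockSum f a l < blockSum f a l' := by
  obtain ⟨c, rfl⟩ := Nat.exists_eq_add_of_lt h
  rw [add_assoc, blockSum_add, blockSum, blockSum, Finset.sum_range_succ]
  omega

theorem blockSum_start_add_mul (hf : Function.Periodic f p) (a q l : ℕ) :
    blockSum f (a + q * p) l = blockSum f a l := by
  refine Finset.sum_congr rfl fun k _ => ?_
  rw [show a + q * p + k = a + k + q * p by ring, ← smul_eq_mul, hf.nsmul q (a + k)]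

theorem blockSum_period (hf : Function.Periodic f p) (a : ℕ) :
    blockSum f a p = blockSum f 0 p := by
  induction a with
  | zero => rfl
  | succ a ih =>
    have h₁ := blockSum_add f a 1 p
    have h₂ := blockSum_add f a p 1
    have h₃ := blockSum_start_add_mul hf a 1 1
    rw [one_mul] at h₃
    rw [add_comm 1 p] at h₁
    omega

theorem blockSum_mul_period (hf : Function.Periodic f p) (a q : ℕ) :
    blockSum f a (q * p) = q * blockSum f 0 p := by
  induction q with
  | zero => simp [blockSum]
  | succ q ih => rw [add_one_mul, blockSum_add, ih, blockSum_period hf (a + q * p), add_one_mul]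

theorem admissibleSeq_mul_iff (hf : Function.Periodic f p) (hp : p ≠ 0) {d : ℕ} (hd : d ≠ 0) :
    AdmissibleSeq (d * p) f ↔ Odd d ∧ AdmissibleSeq p f := by
  have hsum : blockSum f 0 (d * p) = 2 * (d * p) ↔ blockSum f 0 p = 2 * p := by
    rw [blockSum_mul_period hf, mul_left_comm]
    exact Nat.mul_right_inj hd
  constructor
  · rintro ⟨-, h₁, h₂⟩
    rw [hsum] at h₁
    have hodd : Odd d := by
      rw [← Nat.not_even_iff_odd]
      rintro ⟨e, rfl⟩
      apply h₂ 0 (e * p)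
      rw [blockSum_mul_period hf, h₁]
      ring
    refine ⟨hodd, hf, h₁, fun a l hl => ?_⟩
    obtain ⟨k, rfl⟩ := hodd
    apply h₂ a (k * p + l)
    rw [blockSum_add, blockSum_mul_period hf, blockSum_start_add_mul hf, h₁, hl]
    ring
  · rintro ⟨⟨k, rfl⟩, -, h₁, h₂⟩
    refine ⟨hf.nsmul _, hsum.mpr h₁, fun a l hl => ?_⟩
    have hlt := blockSum_lt_blockSum f a (Nat.mod_lt l (Nat.pos_of_ne_zero hp))
    rw [blockSum_period hf, h₁] at hlt
    rw [← Nat.div_add_mod' l p, blockSum_add, blockSum_mul_period hf,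
      blockSum_start_add_mul hf, h₁] at hl
    have hk : l / p = k := by
      apply le_antisymm
      · by_contra! hlt'
        nlinarith [Nat.mul_le_mul_right p hlt', Nat.pos_of_ne_zero hp]
      · by_contra! hlt'
        nlinarith [Nat.mul_le_mul_right p hlt', Nat.pos_of_ne_zero hp]
    apply h₂ a (l % p)
    rw [hk] at hl
    linarith

end Sequences

section Tuples

variable {N : ℕ}

/-- The `N`-periodic extension of an `N`-tuple. -/
def periodicExt (hN : 0 < N) (lam : Fin N → ℕ) (k : ℕ) : ℕ := lam ⟨k % N, Nat.mod_lt k hN⟩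

theorem periodicExt_periodic (hN : 0 < N) (lam : Fin N → ℕ) :
    Function.Periodic (periodicExt hN lam) N := fun k => by
  simp [periodicExt]

theorem periodicExt_val (hN : 0 < N) (lam : Fin N → ℕ) (k : Fin N) :
    periodicExt hN lam k = lam k := by
  simp [periodicExt, Nat.mod_eq_of_lt k.isLt]

theorem periodicExt_injective (hN : 0 < N) :
    Function.Injective (periodicExt hN) := fun lam mu h => by
  funext k
  rw [← periodicExt_val hN lam, h, periodicExt_val]

theorem periodicExt_restrict (hN : 0 < N) {f : ℕ → ℕ} (hf : Function.Periodic f N) :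
    periodicExt hN (fun k => f k) = f := by
  funext k
  exact hf.map_mod_nat k

theorem isPeriodic_iff (hN : 0 < N) (lam : Fin N → ℕ) (d : ℕ) :
    IsPeriodic N d lam ↔ Function.Periodic (periodicExt hN lam) d := by
  constructor
  · intro h k
    have := h ⟨k % N, Nat.mod_lt k hN⟩
    simpa [periodicExt] using this
  · intro h k
    rw [← periodicExt_val hN lam k, ← h k]
    rfl

theorem sum_Icc_eq_blockSum (hN : 0 < N) (lam : Fin N → ℕ) (i j : Fin N) :
    ∑ k ∈ Finset.Icc i j, (lam k + 1) = blockSum (periodicExt hN lam) i (j + 1 - i) := by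
  have h₁ : ∑ k ∈ Finset.Icc i j, (lam k + 1)
      = ∑ k ∈ Finset.Icc (i : ℕ) j, (periodicExt hN lam k + 1) := by
    rw [← Fin.map_valEmbedding_Icc, Finset.sum_map]
    exact Finset.sum_congr rfl fun k _ => by simp [periodicExt_val]
  rw [h₁, blockSum, ← Finset.sum_Ico_eq_sum_range (fun k => periodicExt hN lam k + 1)]
  rfl

theorem admissible_iff (hN : 0 < N) (lam : Fin N → ℕ) :
    Admissible N lam ↔ AdmissibleSeq N (periodicExt hN lam) := by
  have hper := periodicExt_periodic hN lam
  have hsum : ∑ i, (lam i + 1) = blockSum (periodicExt hN lam) 0 N := by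
    rw [blockSum, ← Fin.sum_univ_eq_sum_range (fun k => periodicExt hN lam (0 + k) + 1)]
    simp [periodicExt_val]
  rw [Admissible, AdmissibleSeq, hsum]
  refine ⟨fun ⟨h₁, h₂⟩ => ⟨hper, h₁, fun a l hl => ?_⟩, fun ⟨_, h₁, h₂⟩ => ⟨h₁, fun i j _ => ?_⟩⟩
  · have hblock (b c : ℕ) (hc : 0 < c) (hbc : b + c ≤ N) :
        blockSum (periodicExt hN lam) b c ≠ N := by
      have hle : (⟨b, by omega⟩ : Fin N) ≤ ⟨b + c - 1, by omega⟩ := by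
        rw [Fin.mk_le_mk]; omega
      have := h₂ _ _ hle
      rw [sum_Icc_eq_blockSum hN] at this
      rwa [show b + c - 1 + 1 - b = c by omega] at this
    have hl0 : 0 < l := by
      rcases Nat.eq_zero_or_pos l with rfl | h
      · simp [blockSum] at hl; omega
      · exact h
    have hlN : l < N := by
      by_contra! hle
      have h₃ := blockSum_period hper a
      rcases hle.eq_or_lt with rfl | hlt
      · omega
      · have := blockSum_lt_blockSum (periodicExt hN lam) a hlt
        omega
    rw [← Nat.mod_add_div' a N, blockSum_start_add_mul hper] at hl
    have ha := Nat.mod_lt a hN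
    generalize a % N = b at hl ha
    by_cases hbl : b + l ≤ N
    · exact hblock b l hl0 hbl hl
    · have h₃ := blockSum_add (periodicExt hN lam) b l (N - l)
      rw [Nat.add_sub_cancel' hlN.le, blockSum_period hper, h₁, hl] at h₃
      have h₄ := blockSum_start_add_mul hper (b + l - N) 1 (N - l)
      rw [one_mul, Nat.sub_add_cancel (by omega)] at h₄
      exact hblock (b + l - N) (N - l) (by omega) (by omega) (by omega)
  · rw [sum_Icc_eq_blockSum hN]
    exact h₂ _ _

theorem periodicExt_shift (hN : 0 < N) (lam : Fin N → ℕ) (k : ℕ) :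
    periodicExt hN (shift N lam) k = periodicExt hN lam (k + 1) := by
  simp [periodicExt, shift]

/-- Admissible `N`-tuples subject to a condition on their periodic extension correspond to
admissible sequences subject to that condition. -/
noncomputable def admissibleEquiv (hN : 0 < N) (C : (ℕ → ℕ) → Prop) :
    {lam : Fin N → ℕ // Admissible N lam ∧ C (periodicExt hN lam)} ≃
      {f : ℕ → ℕ // AdmissibleSeq N f ∧ C f} :=
  Equiv.ofBijective
    (fun lam => ⟨periodicExt hN lam, (admissible_iff hN _).mp lam.2.1, lam.2.2⟩)
    ⟨fun _ _ h => Subtype.ext (periodicExt_injective hN (congrArg Subtype.val h)),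
      fun ⟨f, hf, hC⟩ => by
        have hr := periodicExt_restrict hN hf.1
        exact ⟨⟨fun k => f k, (admissible_iff hN _).mpr (hr.symm ▸ hf), hr.symm ▸ hC⟩,
          Subtype.ext hr⟩⟩

theorem numAperiodic_eq (hN : 0 < N) :
    numAperiodic N = Nat.card {f : ℕ → ℕ // AdmissibleSeq N f ∧ IsLeastPeriod f N} := by
  rw [← Nat.card_congr (admissibleEquiv hN (IsLeastPeriod · N))]
  refine Nat.card_congr (Equiv.subtypeEquivRight fun lam => and_congr_right fun _ => ?_)
  simp only [Aperiodic, IsLeastPeriod, isPeriodic_iff hN, periodicExt_periodic hN lam, true_and]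

theorem finite_admissible (N : ℕ) : Finite {lam : Fin N → ℕ // Admissible N lam} := by
  refine Set.Finite.subset (Set.finite_Iic (fun _ : Fin N => 2 * N)) ?_
  intro lam hlam i
  have := Finset.single_le_sum (f := fun i => lam i + 1) (fun _ _ => Nat.zero_le _)
    (Finset.mem_univ i)
  have := hlam.1
  simp only at *
  omega

variable {σ : {lam : Fin N → ℕ // Admissible N lam} → {lam : Fin N → ℕ // Admissible N lam}}

theorem periodicExt_iterate (hN : 0 < N) (hσ : ∀ l, (σ l : Fin N → ℕ) = shift N l) (j : ℕ)
    (x : {lam : Fin N → ℕ // Admissible N lam}) (k : ℕ) :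
    periodicExt hN (σ^[j] x : Fin N → ℕ) k = periodicExt hN x (k + j) := by
  induction j generalizing k with
  | zero => rfl
  | succ j ih =>
    rw [Function.iterate_succ_apply', hσ, periodicExt_shift, ih]
    congr 1
    omega

theorem isPeriodicPt_iff (hN : 0 < N) (hσ : ∀ l, (σ l : Fin N → ℕ) = shift N l) (j : ℕ)
    (x : {lam : Fin N → ℕ // Admissible N lam}) :
    Function.IsPeriodicPt σ j x ↔ Function.Periodic (periodicExt hN x) j := by
  rw [Function.IsPeriodicPt, Function.IsFixedPt, Subtype.ext_iff,
    ← (periodicExt_injective hN).eq_iff, funext_iff]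
  simp only [periodicExt_iterate hN hσ, Function.Periodic]

theorem minimalPeriod_eq_iff (hN : 0 < N) (hσ : ∀ l, (σ l : Fin N → ℕ) = shift N l) {p : ℕ}
    (hp : 0 < p) (x : {lam : Fin N → ℕ // Admissible N lam}) :
    Function.minimalPeriod σ x = p ↔ IsLeastPeriod (periodicExt hN x) p := by
  simp only [IsLeastPeriod, ← isPeriodicPt_iff hN hσ]
  constructor
  · rintro rfl
    exact ⟨Function.isPeriodicPt_minimalPeriod σ x,
      fun d hd hle h => hle.antisymm (h.minimalPeriod_le hd)⟩
  · rintro ⟨h, hmin⟩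
    exact hmin _ (h.minimalPeriod_pos hp) (h.minimalPeriod_le hp)
      (Function.isPeriodicPt_minimalPeriod σ x)

theorem card_minimalPeriod_eq (hN : 0 < N) (hσ : ∀ l, (σ l : Fin N → ℕ) = shift N l) {d : ℕ}
    (hd : d ∣ N) :
    Nat.card {x // Function.minimalPeriod σ x = N / d}
      = if Odd d then numAperiodic (N / d) else 0 := by
  obtain ⟨p, rfl⟩ := hd
  have hd0 : 0 < d := Nat.pos_of_mul_pos_right hN
  have hp0 : 0 < p := Nat.pos_of_mul_pos_left hN
  rw [Nat.mul_div_cancel_left _ hd0, numAperiodic_eq hp0]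
  have e : {x // Function.minimalPeriod σ x = p} ≃
      {f : ℕ → ℕ // Odd d ∧ AdmissibleSeq p f ∧ IsLeastPeriod f p} :=
    (Equiv.subtypeEquivRight fun x => minimalPeriod_eq_iff hN hσ hp0 x).trans <|
      (Equiv.subtypeSubtypeEquivSubtypeInter (Admissible (d * p))
        (fun lam => IsLeastPeriod (periodicExt hN lam) p)).trans <|
      (admissibleEquiv hN (IsLeastPeriod · p)).trans <|
      Equiv.subtypeEquivRight fun f => by
        rw [← and_assoc]
        exact and_congr_left fun h => admissibleSeq_mul_iff h.1 hp0.ne' hd0.ne'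
  rw [Nat.card_congr e]
  split_ifs with h <;> simp [h]

end Tuples

theorem exp_pow_div_eq_one_iff {N d : ℕ} (hN : N ≠ 0) (hd : d ∣ N) (m : ℤ) :
    Complex.exp (2 * Real.pi * Complex.I * m / N) ^ (N / d) = 1 ↔ (d : ℤ) ∣ m := by
  obtain ⟨p, rfl⟩ := hd
  have hd0 : d ≠ 0 := left_ne_zero_of_mul hN
  have hp0 : p ≠ 0 := right_ne_zero_of_mul hN
  have hdC : (d : ℂ) ≠ 0 := Nat.cast_ne_zero.mpr hd0
  have hpC : (p : ℂ) ≠ 0 := Nat.cast_ne_zero.mpr hp0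
  rw [Nat.mul_div_cancel_left _ (Nat.pos_of_ne_zero hd0), ← Complex.exp_nat_mul,
    Complex.exp_eq_one_iff]
  refine exists_congr fun n => ?_
  have h2 := Complex.two_pi_I_ne_zero
  have hl : (p : ℂ) * (2 * Real.pi * Complex.I * m / ((d * p : ℕ) : ℂ))
      = (m / d : ℂ) * (2 * Real.pi * Complex.I) := by
    push_cast
    field_simp
  rw [hl, mul_left_inj' h2, div_eq_iff hdC, mul_comm]
  norm_cast

/-- eigenvalue multiplicities of the one-form symmetry (cyclic shift) on
the vacua: `N · dim_ℂ eigenspace(P_σ, exp(2πi m/N)) = ∑_{d ∣ N, d odd, d ∣ m} d · A_{N/d}`,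
where `P_σ` is the pullback of the cyclic shift `σ` acting on complex-valued functions on
the set of admissible `N`-tuples. -/
theorem eigenspace_dim_shift (N : ℕ) (hN : 1 ≤ N) (m : ℤ)
    (σ : {lam : Fin N → ℕ // Admissible N lam} → {lam : Fin N → ℕ // Admissible N lam})
    (hσ : ∀ l, (σ l : Fin N → ℕ) = shift N l) :
    N * Module.finrank ℂ
        (Module.End.eigenspace (LinearMap.funLeft ℂ ℂ σ)
          (Complex.exp (2 * Real.pi * Complex.I * m / N)))
      = ∑ d ∈ N.divisors.filter (fun d : ℕ => Odd d ∧ (d : ℤ) ∣ m),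
          d * numAperiodic (N / d) := by
  classical
  have hN0 : 0 < N := hN
  have := finite_admissible N
  have := Fintype.ofFinite {lam : Fin N → ℕ // Admissible N lam}
  have hiter : σ^[N] = id := funext fun x =>
    (isPeriodicPt_iff hN0 hσ N x).mpr (periodicExt_periodic hN0 _)
  have hdvd (x) : Function.minimalPeriod σ x ∣ N :=
    Function.IsPeriodicPt.minimalPeriod_dvd (congrFun hiter x)
  have hω : Complex.exp (2 * Real.pi * Complex.I * m / N) ^ N = 1 := by
    simpa using (exp_pow_div_eq_one_iff hN0.ne' (one_dvd N) m).mpr (by simp)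
  rw [mul_finrank_eigenspace_funLeft σ hN0.ne' hiter hω,
    ← Finset.sum_fiberwise_of_maps_to (t := N.divisors)
      (g := fun x => N / Function.minimalPeriod σ x)
      fun x _ => Nat.mem_divisors.mpr ⟨Nat.div_dvd_of_dvd (hdvd x), hN0.ne'⟩,
    Finset.sum_filter]
  refine Finset.sum_congr rfl fun d hd => ?_
  have hdN := Nat.dvd_of_mem_divisors hd
  have hiff (x) : N / Function.minimalPeriod σ x = d ↔ Function.minimalPeriod σ x = N / d :=
    ⟨fun h => by rw [← h, Nat.div_div_self (hdvd x) hN0.ne'],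
      fun h => by rw [h, Nat.div_div_self hdN hN0.ne']⟩
  simp_rw [hiff]
  have hcard := card_minimalPeriod_eq hN0 hσ hdN
  rw [Nat.card_eq_fintype_card, Fintype.card_subtype] at hcard
  rw [Finset.sum_congr rfl fun x hx => by
      rw [(Finset.mem_filter.mp hx).2, Nat.div_div_self hdN hN0.ne'],
    Finset.sum_const, hcard, smul_eq_mul]
  simp only [exp_pow_div_eq_one_iff hN0.ne' hdN]
  split_ifs <;> simp_all [mul_comm]
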